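/- Algebraic identity behind Corollary 4.1 (E_q = Λ₁^q under the null): Let p, q ≥ 1 and θ ∈ ℝ^p, and let (ℓ_h)_{h∈ℤ} be a real sequence with ℓ_{−h} = ℓ_h satisfying the AR(p) Yule–Walker relations ℓ_h = θ₁ℓ_{h−1} + ⋯ + θ_pℓ_{h−p} for every h ≥ 1. Then for every 1 ≤ i ≤ q, θᵀ(Λ_{i+1}^p + Λ_{−i+1}^p − Γ_i θ) = ℓ_i; that is, the vector E_q with i-th entry θᵀ(Λ_{i+1}^p + Λ_{−i+1}^p − Γ_i θ) equals Λ₁^q = (ℓ₁,…,ℓ_q)ᵀ. -/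

import Mathlib

open MeasureTheory ProbabilityTheory Filter Finset Matrix Kronecker Asymptotics

theorem stmt18
    (p q : ℕ) (hp : 1 ≤ p) (hq : 1 ≤ q)
    (θ : Fin p → ℝ) (l : ℤ → ℝ) (hlsymm : ∀ h : ℤ, l (-h) = l h)
    (hYW : ∀ h : ℤ, 1 ≤ h → l h = ∑ j : Fin p, θ j * l (h - 1 - ((j : ℕ) : ℤ)))
    (Λ : ℤ → Fin p → ℝ) (hΛ : ∀ (h : ℤ) (i : Fin p), Λ h i = l (h + ((i : ℕ) : ℤ)))
    (Γm : ℤ → Matrix (Fin p) (Fin p) ℝ)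
    (hΓm : ∀ (m : ℤ) (i j : Fin p), Γm m i j = l (m + ((i : ℕ) : ℤ) - ((j : ℕ) : ℤ)))
    :
    ∀ i : ℤ, 1 ≤ i → i ≤ (q : ℤ) →
      θ ⬝ᵥ (Λ (i + 1) + Λ (1 - i) - (Γm i).mulVec θ) = l i := by
  intro i hi _
  have backward (a : Fin p) : l (1 - i + (a : ℕ)) = l (i - 1 - (a : ℕ)) := by
    rw [← hlsymm]
    congr 1
    ring
  have forward (a : Fin p) : (Γm i *ᵥ θ) a = l (i + 1 + (a : ℕ)) := by
    rw [hYW (i + 1 + (a : ℕ)) (by lia), mulVec, dotProduct]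
    refine Finset.sum_congr rfl fun b _ => ?_
    rw [hΓm, mul_comm]
    congr 2
    ring
  rw [hYW i hi, dotProduct]
  refine Finset.sum_congr rfl fun a _ => ?_
  rw [Pi.sub_apply, Pi.add_apply, hΛ, hΛ, forward, backward, add_sub_cancel_left]
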